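/- arXiv:1507.08594 — 4 statements merged into one kernel-verified Lean document; each statement's English description precedes it below -/
import Mathlib

section
/- Let $A_1, \ldots, A_m$ be $d\times d$ Hermitian positive semidefinite matrices with $\sum_{i=1}^{m} A_i \leq I_d$ and $\mathrm{Tr}\, A_i \leq \varepsilon$ for all $i$, where $\varepsilon \geq 0$. Define the univariate polynomial $\mu(x) = \prod_{i=1}^{m}(1-\partial_{z_i})\,\det\!\left(xI_d + \sum_{i=1}^{m} z_i A_i\right)\Big|_{z_1=\cdots=z_m=0}$ (the mixed characteristic polynomial). Then every real root $x$ of $\mu$ satisfies $x \leq (1+\sqrt{\varepsilon})^2$; equivalently, $\mu(x) > 0$ for all real $x > (1+\sqrt{\varepsilon})^2$. -/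
open scoped ComplexOrder

section Univariate

open Polynomial Filter Topology ComplexConjugate

/-- The quotient `g / f` maps the open upper half plane to the closed lower half plane. -/
def NevanlinnaPair (f g : ℝ[X]) : Prop :=
  ∀ s : ℂ, 0 < s.im → (aeval s g * conj (aeval s f)).im ≤ 0

theorem eq_one_and_pos_of_forall_im_pow_mul_nonneg {κ : ℝ} (hκ : κ ≠ 0) {n : ℕ} (hn : 1 ≤ n)
    (h : ∀ ω : ℂ, 0 < ω.im → 0 ≤ (ω ^ n * κ).im) : n = 1 ∧ 0 < κ := by
  have hn0 : (0 : ℝ) < n := by exact_mod_cast hn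
  have key : ∀ φ : ℝ, 0 < φ → φ < Real.pi → 0 ≤ Real.sin (n * φ) * κ := by
    intro φ h0 h1
    have h2 := h (Complex.exp (φ * Complex.I)) (by
      rw [Complex.exp_ofReal_mul_I_im]; exact Real.sin_pos_of_pos_of_lt_pi h0 h1)
    rw [← Complex.exp_nat_mul, ← mul_assoc, Complex.im_mul_ofReal] at h2
    have : ((n : ℂ) * (φ : ℂ)) = ((n * φ : ℝ) : ℂ) := by push_cast; rfl
    rwa [this, Complex.exp_ofReal_mul_I_im] at h2
  have hpos : 0 < κ := by
    have h1 := key (Real.pi / (2 * n)) (by positivity) (by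
      rw [div_lt_iff₀ (by positivity)]
      have : (1 : ℝ) ≤ n := by exact_mod_cast hn
      nlinarith [Real.pi_pos])
    have h2 : (n : ℝ) * (Real.pi / (2 * n)) = Real.pi / 2 := by field_simp
    rw [h2, Real.sin_pi_div_two, one_mul] at h1
    exact lt_of_le_of_ne h1 hκ.symm
  refine ⟨?_, hpos⟩
  by_contra hne
  have hn2 : (2 : ℝ) ≤ n := by
    have : 2 ≤ n := by omega
    exact_mod_cast this
  have h1 := key (3 * Real.pi / (2 * n)) (by positivity) (by
    rw [div_lt_iff₀ (by positivity)]
    nlinarith [Real.pi_pos])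
  have h2 : (n : ℝ) * (3 * Real.pi / (2 * n)) = Real.pi / 2 + Real.pi := by field_simp; ring
  rw [h2, Real.sin_add_pi, Real.sin_pi_div_two] at h1
  linarith

theorem NevanlinnaPair.im_pow_mul_nonneg_of_eq {f g : ℝ[X]} (h : NevanlinnaPair f g) {r ω : ℂ}
    {n : ℕ} {F : ℂ[X]} (hF : f.map (algebraMap ℝ ℂ) = (X - C r) ^ n * F)
    (hω : ∀ t : ℝ, 0 < t → t < 1 → 0 < (r + t * ω).im) :
    0 ≤ (ω ^ n * (F.eval r * conj (aeval r g))).im := by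
  have hcont : Continuous fun t : ℝ =>
      (ω ^ n * (F.eval (r + t * ω) * conj (aeval (r + t * ω) g))).im := by
    have : Continuous fun t : ℝ => r + t * ω := by fun_prop
    refine Complex.continuous_im.comp (continuous_const.mul ((F.continuous.comp this).mul
      (Complex.continuous_conj.comp ((g.continuous_aeval).comp this))))
  have hlim := (hcont.tendsto 0).mono_left (nhdsWithin_le_nhds (s := Set.Ioi 0))
  simp only [Complex.ofReal_zero, zero_mul, add_zero] at hlim
  refine ge_of_tendsto hlim ?_
  filter_upwards [Ioo_mem_nhdsGT (show (0 : ℝ) < 1 by norm_num)] with t ht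
  have h1 := h _ (hω t ht.1 ht.2)
  have h2 : aeval (r + t * ω) f = t ^ n * (ω ^ n * F.eval (r + t * ω)) := by
    rw [← eval_map_algebraMap, hF]; simp [mul_pow, mul_assoc]
  have h3 : ((ω ^ n * (F.eval (r + t * ω) * conj (aeval (r + t * ω) g))).im) * t ^ n =
      - (aeval (r + t * ω) g * conj (aeval (r + t * ω) f)).im := by
    rw [← Complex.conj_im, h2]
    simp only [map_mul, Complex.conj_conj, map_pow, Complex.conj_ofReal]
    rw [← Complex.ofReal_pow, ← Complex.im_mul_ofReal]
    simp only [Complex.ofReal_pow]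
    congr 1; ring
  have h4 : 0 < t ^ n := pow_pos ht.1 n
  by_contra hcon
  push Not at hcon
  nlinarith

theorem exists_eq_pow_mul_of_aeval_eq_zero {f : ℝ[X]} (hf : f ≠ 0) {r : ℂ} (hr : aeval r f = 0) :
    ∃ n, 1 ≤ n ∧ ∃ F : ℂ[X], f.map (algebraMap ℝ ℂ) = (X - C r) ^ n * F ∧ F.eval r ≠ 0 := by
  have hf' : f.map (algebraMap ℝ ℂ) ≠ 0 := by simpa using hf
  obtain ⟨F, hF, hd⟩ := exists_eq_pow_rootMultiplicity_mul_and_not_dvd _ hf' r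
  refine ⟨_, ?_, F, hF, fun h => hd (dvd_iff_isRoot.2 h)⟩
  exact (rootMultiplicity_pos hf').2 (by simpa [IsRoot, eval_map_algebraMap] using hr)

theorem NevanlinnaPair.im_nonpos_of_root {f g : ℝ[X]} (h : NevanlinnaPair f g) (hf : f ≠ 0)
    {r : ℂ} (hr : aeval r f = 0) (hg : aeval r g ≠ 0) : r.im ≤ 0 := by
  by_contra! hpos
  obtain ⟨n, hn, F, hF, hF0⟩ := exists_eq_pow_mul_of_aeval_eq_zero hf hr
  set κ := F.eval r * conj (aeval r g) with hκ
  have hκ0 : κ ≠ 0 := mul_ne_zero hF0 (by simpa using hg)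
  obtain ⟨ω, hω⟩ := IsAlgClosed.exists_pow_nat_eq (-Complex.I * κ⁻¹) (n := n) (by omega)
  obtain ⟨c, hc, hc1⟩ : ∃ c : ℝ, 0 < c ∧ c * |ω.im| < r.im := by
    refine ⟨r.im / (2 * (|ω.im| + 1)), by positivity, ?_⟩
    rw [div_mul_eq_mul_div, div_lt_iff₀ (by positivity)]
    nlinarith [abs_nonneg ω.im]
  have h1 := h.im_pow_mul_nonneg_of_eq (ω := c * ω) hF (by
    intro t h0 h1
    have h2 : (r + t * (c * ω)).im = r.im + t * (c * ω.im) := by simp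
    rw [h2]
    have h3 : c * |ω.im| = |c * ω.im| := by rw [abs_mul, abs_of_pos hc]
    rw [h3] at hc1
    have := neg_abs_le (c * ω.im)
    nlinarith [abs_nonneg (c * ω.im)])
  rw [mul_pow, hω, ← hκ, mul_assoc, mul_assoc, inv_mul_cancel₀ hκ0, ← Complex.ofReal_pow,
    Complex.im_ofReal_mul] at h1
  have := pow_pos hc n
  simp at h1
  linarith

theorem NevanlinnaPair.pos_of_root {f g : ℝ[X]} (h : NevanlinnaPair f g) (hf : f ≠ 0)
    {r : ℝ} (hr : f.eval r = 0) (hg : g.eval r ≠ 0) : 0 < g.eval r * f.derivative.eval r := by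
  have hr' : aeval (r : ℂ) f = 0 := by
    have := aeval_algebraMap_apply ℂ r f
    simp_all
  obtain ⟨F, hF, hd⟩ := exists_eq_pow_rootMultiplicity_mul_and_not_dvd f hf r
  have hF0 : F.eval r ≠ 0 := fun h => hd (dvd_iff_isRoot.2 h)
  have hn : 1 ≤ f.rootMultiplicity r := (rootMultiplicity_pos hf).2 hr
  generalize f.rootMultiplicity r = n at hF hn
  have hFm : f.map (algebraMap ℝ ℂ) = (X - C (r : ℂ)) ^ n * F.map (algebraMap ℝ ℂ) := by
    rw [hF]; simp
  have hev : ∀ p : ℝ[X], aeval (r : ℂ) p = ((p.eval r : ℝ) : ℂ) := fun p => by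
    have := aeval_algebraMap_apply ℂ r p
    simpa using this
  have key := eq_one_and_pos_of_forall_im_pow_mul_nonneg (κ := F.eval r * g.eval r)
    (mul_ne_zero hF0 hg) hn (fun ω hω => by
      have := h.im_pow_mul_nonneg_of_eq (ω := ω) hFm (by
        intro t h0 _
        simpa using mul_pos h0 hω)
      rw [eval_map_algebraMap, hev, hev, Complex.conj_ofReal] at this
      simpa using this)
  obtain ⟨rfl, hpos⟩ := key
  have : f.derivative.eval r = F.eval r := by rw [hF]; simp
  rw [this, mul_comm]; exact hpos

theorem tendsto_aeval_div_pow_atTop (f : ℝ[X]) {ω : ℂ} (hω : ω ≠ 0) :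
    Tendsto (fun t : ℝ => aeval (t * ω) f / (t * ω) ^ f.natDegree) atTop
      (𝓝 (f.leadingCoeff : ℂ)) := by
  have h1 : Tendsto (fun t : ℝ => ((t : ℂ) * ω)⁻¹) atTop (𝓝 0) := by
    have : Tendsto (fun t : ℝ => ((t⁻¹ : ℝ) : ℂ) * ω⁻¹) atTop (𝓝 (((0 : ℝ) : ℂ) * ω⁻¹)) :=
      ((Complex.continuous_ofReal.tendsto 0).comp tendsto_inv_atTop_zero).mul_const _
    simpa [mul_inv, mul_comm] using this
  have h2 : Tendsto (fun t : ℝ => aeval (((t : ℂ) * ω)⁻¹) f.reverse) atTop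
      (𝓝 (aeval (0 : ℂ) f.reverse)) := (f.reverse.continuous_aeval.tendsto 0).comp h1
  have h3 : aeval (0 : ℂ) f.reverse = (f.leadingCoeff : ℂ) := by
    rw [← coeff_zero_eq_aeval_zero']; simp
  rw [h3] at h2
  refine h2.congr' ?_
  filter_upwards [eventually_gt_atTop 0] with t ht
  have hne : (t : ℂ) * ω ≠ 0 := mul_ne_zero (by exact_mod_cast ht.ne') hω
  let _ := invertibleOfNonzero hne
  have := eval₂_reverse_mul_pow (algebraMap ℝ ℂ) ((t : ℂ) * ω) f
  rw [eq_div_iff (pow_ne_zero _ hne), aeval_def, aeval_def, ← this, invOf_eq_inv]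

theorem NevanlinnaPair.natDegree_of_lt {f g : ℝ[X]} (h : NevanlinnaPair f g) (hf : f ≠ 0)
    (hlt : f.natDegree < g.natDegree) :
    g.natDegree = f.natDegree + 1 ∧ g.leadingCoeff * f.leadingCoeff < 0 := by
  obtain ⟨N, hN⟩ := Nat.exists_eq_add_of_lt hlt
  have hg : g ≠ 0 := by rintro rfl; simp at hlt
  have key := eq_one_and_pos_of_forall_im_pow_mul_nonneg
    (κ := -(g.leadingCoeff * f.leadingCoeff)) (n := N + 1)
    (neg_ne_zero.2 (mul_ne_zero (leadingCoeff_ne_zero.2 hg) (leadingCoeff_ne_zero.2 hf)))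
    (by omega) (fun ω hω => by
      have hω0 : ω ≠ 0 := by rintro rfl; simp at hω
      have hl := (((tendsto_aeval_div_pow_atTop g hω0).mul ((Complex.continuous_conj.tendsto _).comp
        (tendsto_aeval_div_pow_atTop f hω0))).const_mul (ω ^ (N + 1)))
      have hl2 := (Complex.continuous_im.tendsto _).comp hl
      have hle := le_of_tendsto hl2 (b := 0) (by
        filter_upwards [eventually_gt_atTop 0] with t ht
        have hne : (t : ℂ) * ω ≠ 0 := mul_ne_zero (by exact_mod_cast ht.ne') hω0
        have h1 := h (t * ω) (by simpa using mul_pos ht hω)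
        have h2 : aeval (t * ω) g * conj (aeval (t * ω) f) =
            ((t ^ (N + 1) * Complex.normSq (t * ω) ^ f.natDegree : ℝ) : ℂ) *
            (ω ^ (N + 1) * (aeval (t * ω) g / (t * ω) ^ g.natDegree *
              conj (aeval (t * ω) f / (t * ω) ^ f.natDegree))) := by
          have hcne : conj ((t : ℂ) * ω) ≠ 0 := by simpa using hne
          push_cast
          rw [Complex.normSq_eq_conj_mul_self, map_div₀, map_pow, hN]
          have hh : ((t : ℂ) * ω) ^ (f.natDegree + N + 1) =
            ((t : ℂ) * ω) ^ f.natDegree * (t ^ (N + 1) * ω ^ (N + 1)) := by ring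
          have ht0 : (t : ℂ) ≠ 0 := by exact_mod_cast ht.ne'
          rw [hh, mul_pow (conj _)]
          generalize conj ((t : ℂ) * ω) = u at hcne ⊢
          generalize (t : ℂ) * ω = v at hne ⊢
          field_simp
        rw [h2, Complex.im_ofReal_mul] at h1
        have h3 : 0 < t ^ (N + 1) * Complex.normSq (t * ω) ^ f.natDegree :=
          mul_pos (pow_pos ht _) (pow_pos (Complex.normSq_pos.2 hne) _)
        exact nonpos_of_mul_nonpos_right h1 h3)
      simp only [Complex.conj_ofReal] at hle
      push_cast
      rw [mul_neg, Complex.neg_im]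
      linarith)
  obtain ⟨h1, h2⟩ := key
  exact ⟨by omega, by linarith⟩


theorem NevanlinnaPair.splits {f g : ℝ[X]} (h : NevanlinnaPair f g) (hf : f ≠ 0)
    (hfg : IsCoprime f g) : f.Splits := by
  refine Splits.of_splits_map (algebraMap ℝ ℂ) (IsAlgClosed.splits _) fun r hr => ?_
  have hr0 : aeval r f = 0 := by
    simpa [IsRoot, eval_map_algebraMap] using isRoot_of_mem_roots hr
  have key : ∀ z : ℂ, aeval z f = 0 → z.im ≤ 0 := fun z hz =>
    h.im_nonpos_of_root hf hz fun hgz => by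
      obtain ⟨u, v, huv⟩ := hfg
      have := congrArg (aeval z) huv
      simp [hz, hgz] at this
  have h1 := key r hr0
  have h2 := key (conj r) (by rw [aeval_conj, hr0, map_zero])
  rw [Complex.conj_im] at h2
  exact ⟨r.re, Complex.ext (by simp) (by simp; linarith)⟩

theorem NevanlinnaPair.exists_partialFractions_of_isCoprime {f g : ℝ[X]} (h : NevanlinnaPair f g)
    (hf : f ≠ 0) (hfg : IsCoprime f g) :
    ∃ (α β : ℝ) (c : ℝ → ℝ), β ≤ 0 ∧ (∀ r ∈ f.roots.toFinset, 0 ≤ c r) ∧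
      ∀ x, f.eval x ≠ 0 →
        g.eval x / f.eval x = α + β * x + ∑ r ∈ f.roots.toFinset, c r / (x - r) := by
  have hgr : ∀ r, f.eval r = 0 → g.eval r ≠ 0 := fun r hr hgr => by
    obtain ⟨u, v, huv⟩ := hfg
    have := congrArg (eval r) huv
    simp [hr, hgr] at this
  have hpos : ∀ r ∈ f.roots.toFinset, 0 < g.eval r * f.derivative.eval r := fun r hr => by
    have hr0 : f.eval r = 0 := by simpa [hf] using hr
    exact h.pos_of_root hf hr0 (hgr r hr0)
  have hnodup : f.roots.Nodup := by
    rw [Multiset.nodup_iff_count_le_one]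
    intro r
    rw [count_roots]
    by_contra! hr
    have hr1 := (one_lt_rootMultiplicity_iff_isRoot hf).1 hr
    have := hpos r (by simpa [hf] using hr1.1)
    rw [show f.derivative.eval r = 0 from hr1.2] at this
    simp at this
  set S := f.roots.toFinset with hS
  set F := Lagrange.nodal S id with hFdef
  have hFm : F.Monic := Lagrange.nodal_monic
  set c := f.leadingCoeff with hc
  have hc0 : c ≠ 0 := leadingCoeff_ne_zero.2 hf
  have hfF : f = C c * F := by
    conv_lhs => rw [(h.splits hf hfg).eq_prod_roots]
    rw [hFdef, Lagrange.nodal_eq, Finset.prod_eq_multiset_prod, hS, Multiset.toFinset_val,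
      Multiset.dedup_eq_self.2 hnodup]
    rfl
  have hdegF : F.natDegree = f.natDegree := by rw [hfF, natDegree_C_mul hc0]
  have hFr : ∀ r ∈ S, F.eval r = 0 := fun r hr => Lagrange.eval_nodal_at_node (v := id) hr
  have hQ1 : (g /ₘ F).natDegree ≤ 1 := by
    rw [natDegree_divByMonic _ hFm, hdegF]
    by_contra! hcon
    have := (h.natDegree_of_lt hf (by omega)).1
    omega
  have hQ2 : (g /ₘ F).coeff 1 / c ≤ 0 := by
    rcases Nat.lt_or_ge f.natDegree g.natDegree with hlt | hge
    · obtain ⟨h1, h2⟩ := h.natDegree_of_lt hf hlt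
      have h3 : (g /ₘ F).coeff 1 = g.leadingCoeff := by
        rw [← leadingCoeff_divByMonic_of_monic hFm (p := g) (degree_le_of_natDegree_le (by omega) |>.trans
          (degree_eq_natDegree (by rintro rfl; simp at hlt)).ge)]
        rw [leadingCoeff, natDegree_divByMonic _ hFm, hdegF, h1]
        simp
      rw [h3]
      exact (div_neg_iff.2 (mul_neg_iff.1 h2)).le
    · rw [coeff_eq_zero_of_natDegree_lt, zero_div]
      rw [natDegree_divByMonic _ hFm, hdegF]
      omega
  have hrem : g %ₘ F = Lagrange.interpolate S id (fun r => g.eval r) := by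
    refine Lagrange.eq_interpolate_of_eval_eq _ (Set.injOn_id _) ?_ fun r hr => ?_
    · rw [← Lagrange.degree_nodal (v := id)]
      exact degree_modByMonic_lt _ hFm
    · have := congrArg (eval r) (modByMonic_add_div g F)
      simpa [hFr r hr] using this
  refine ⟨(g /ₘ F).coeff 0 / c, (g /ₘ F).coeff 1 / c, fun r => g.eval r / f.derivative.eval r, hQ2,
    fun r hr => (div_pos_iff.2 (mul_pos_iff.1 (hpos r hr))).le, fun x hx => ?_⟩
  have hxS : ∀ r ∈ S, x ≠ id r := by
    rintro r hr rfl
    exact hx (by simpa [hS, hf] using hr)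
  have hg : g.eval x = F.eval x * ((g /ₘ F).coeff 1 * x + (g /ₘ F).coeff 0 +
      ∑ r ∈ S, c * (g.eval r / f.derivative.eval r / (x - r))) := by
    conv_lhs => rw [← modByMonic_add_div g F]
    rw [eval_add, eval_mul, hrem, Lagrange.eval_interpolate_not_at_node _ hxS]
    conv_lhs => rw [eq_X_add_C_of_natDegree_le_one hQ1]
    rw [mul_add, add_comm]
    congr 1
    · simp
    · congr 1
      refine Finset.sum_congr rfl fun r hr => ?_
      rw [Lagrange.nodalWeight_eq_eval_derivative_nodal hr, ← hFdef]
      have hd : f.derivative.eval r = c * F.derivative.eval r := by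
        conv_lhs => rw [hfF]
        simp
      simp only [hd, id]
      field_simp
  have hFx : F.eval x ≠ 0 := fun h0 => hx (by rw [hfF]; simp [h0])
  have hfx : f.eval x = c * F.eval x := by conv_lhs => rw [hfF, eval_mul, eval_C]
  rw [hfx, hg, ← Finset.mul_sum]
  field_simp
  ring

theorem NevanlinnaPair.exists_partialFractions {f g : ℝ[X]} (h : NevanlinnaPair f g) (hf : f ≠ 0) :
    ∃ (α β : ℝ) (S : Finset ℝ) (c : ℝ → ℝ), β ≤ 0 ∧ (∀ r ∈ S, 0 ≤ c r ∧ f.eval r = 0) ∧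
      ∀ x, f.eval x ≠ 0 → g.eval x / f.eval x = α + β * x + ∑ r ∈ S, c r / (x - r) := by
  set d := EuclideanDomain.gcd f g with hd
  obtain ⟨f₁, hf₁⟩ : d ∣ f := EuclideanDomain.gcd_dvd_left f g
  obtain ⟨g₁, hg₁⟩ : d ∣ g := EuclideanDomain.gcd_dvd_right f g
  have hd0 : d ≠ 0 := by rintro h0; rw [h0, zero_mul] at hf₁; exact hf hf₁
  have hf₁0 : f₁ ≠ 0 := by rintro rfl; rw [mul_zero] at hf₁; exact hf hf₁
  have hco : IsCoprime f₁ g₁ := by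
    refine ⟨EuclideanDomain.gcdA f g, EuclideanDomain.gcdB f g, mul_left_cancel₀ hd0 ?_⟩
    have := EuclideanDomain.gcd_eq_gcd_ab f g
    rw [← hd] at this
    calc d * (EuclideanDomain.gcdA f g * f₁ + EuclideanDomain.gcdB f g * g₁)
        = (d * f₁) * EuclideanDomain.gcdA f g + (d * g₁) * EuclideanDomain.gcdB f g := by ring
      _ = d * 1 := by rw [← hf₁, ← hg₁, ← this, mul_one]
  have h₁ : NevanlinnaPair f₁ g₁ := by
    intro s hs
    have hcont : Continuous fun z : ℂ => (aeval z g₁ * conj (aeval z f₁)).im :=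
      Complex.continuous_im.comp (g₁.continuous_aeval.mul
        (Complex.continuous_conj.comp f₁.continuous_aeval))
    refine le_of_tendsto ((hcont.tendsto s).mono_left nhdsWithin_le_nhds : Tendsto _ (𝓝[≠] s) _) ?_
    have hfin : {z : ℂ | aeval z d = 0}.Finite := by
      have : d.map (algebraMap ℝ ℂ) ≠ 0 := by simpa using hd0
      refine (finite_setOfPred_isRoot this).subset fun z hz => ?_
      simpa [IsRoot, eval_map_algebraMap] using hz
    have hev : ∀ᶠ z in 𝓝[≠] s, aeval z d ≠ 0 := by
      have hcl := (hfin.subset (Set.sdiff_subset (t := {s}))).isClosed.compl_mem_nhds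
        (show s ∉ {z : ℂ | aeval z d = 0} \ {s} by simp)
      filter_upwards [nhdsWithin_le_nhds hcl, self_mem_nhdsWithin] with z hz hzs hz0
      exact hz ⟨hz0, hzs⟩
    have him : ∀ᶠ z in 𝓝[≠] s, 0 < z.im :=
      nhdsWithin_le_nhds ((isOpen_lt continuous_const Complex.continuous_im).mem_nhds hs)
    filter_upwards [hev, him] with z hz hzi
    have h2 := h z hzi
    rw [hf₁, hg₁] at h2
    have h3 : aeval z (d * g₁) * conj (aeval z (d * f₁)) =
        (Complex.normSq (aeval z d) : ℂ) * (aeval z g₁ * conj (aeval z f₁)) := by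
      rw [Complex.normSq_eq_conj_mul_self]; simp only [map_mul]; ring
    rw [h3, Complex.im_ofReal_mul] at h2
    exact nonpos_of_mul_nonpos_right h2 (Complex.normSq_pos.2 hz)
  obtain ⟨α, β, c, hβ, hc, hx⟩ := h₁.exists_partialFractions_of_isCoprime hf₁0 hco
  refine ⟨α, β, f₁.roots.toFinset, c, hβ, fun r hr => ⟨hc r hr, ?_⟩, fun x hfx => ?_⟩
  · have : f₁.eval r = 0 := by simpa [hf₁0] using hr
    rw [hf₁, eval_mul, this, mul_zero]
  · rw [hf₁, eval_mul] at hfx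
    rw [← hx x (right_ne_zero_of_mul hfx)]
    conv_lhs => rw [hf₁, hg₁, eval_mul, eval_mul]
    rw [mul_div_mul_left _ _ (left_ne_zero_of_mul hfx)]

/-- The quotient `g / f` is decreasing and convex to the right of the roots of `f`. -/
theorem NevanlinnaPair.deriv_nonpos_and_tangent_le {f g : ℝ[X]} (h : NevanlinnaPair f g) {a b : ℝ}
    (hab : a ≤ b) (hf : ∀ x, a ≤ x → f.eval x ≠ 0) {κ : ℝ}
    (hκ : κ = (g.derivative.eval b * f.eval b - g.eval b * f.derivative.eval b) / f.eval b ^ 2) :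
    κ ≤ 0 ∧ g.eval b / f.eval b - (b - a) * κ ≤ g.eval a / f.eval a := by
  have hf0 : f ≠ 0 := by rintro rfl; exact hf a le_rfl (by simp)
  obtain ⟨α, β, S, c, hβ, hc, hrep⟩ := h.exists_partialFractions hf0
  have hSa : ∀ r ∈ S, r < a := fun r hr => by
    by_contra! hcon
    exact hf r hcon (hc r hr).2
  have hd1 : HasDerivAt (fun x => g.eval x / f.eval x) κ b := by
    rw [hκ]
    exact (g.hasDerivAt b).div (f.hasDerivAt b) (hf b hab)
  have hd2 : HasDerivAt (fun x => α + β * x + ∑ r ∈ S, c r / (x - r))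
      (β + ∑ r ∈ S, -(c r / (b - r) ^ 2)) b := by
    refine HasDerivAt.add ?_ (HasDerivAt.fun_sum fun r hr => ?_)
    · simpa using ((hasDerivAt_id b).const_mul β).const_add α
    · have hne : b - r ≠ 0 := by linarith [hSa r hr]
      have := (((hasDerivAt_id b).sub_const r).inv hne).const_mul (c r)
      simp only [id] at this
      exact (this.congr_deriv (by ring)).congr_of_eventuallyEq (.of_forall fun x => div_eq_mul_inv _ _)
  have heq : (fun x => g.eval x / f.eval x) =ᶠ[𝓝 b]
      (fun x => α + β * x + ∑ r ∈ S, c r / (x - r)) := by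
    filter_upwards [f.continuous.continuousAt.eventually_ne (hf b hab)] with x hx
    exact hrep x hx
  have hκ' := (hd1.congr_of_eventuallyEq heq.symm).unique hd2
  constructor
  · rw [hκ']
    have : ∑ r ∈ S, -(c r / (b - r) ^ 2) ≤ 0 :=
      Finset.sum_nonpos fun r hr => neg_nonpos.2 (div_nonneg (hc r hr).1 (sq_nonneg _))
    linarith
  · rw [hrep b (hf b hab), hrep a (hf a le_rfl), hκ', mul_add, Finset.mul_sum]
    have : ∑ r ∈ S, c r / (b - r) - ∑ r ∈ S, (b - a) * -(c r / (b - r) ^ 2) ≤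
        ∑ r ∈ S, c r / (a - r) := by
      rw [← Finset.sum_sub_distrib]
      refine Finset.sum_le_sum fun r hr => ?_
      have ha : 0 < a - r := by linarith [hSa r hr]
      have hb : 0 < b - r := by linarith
      have : c r / (a - r) - (c r / (b - r) - (b - a) * -(c r / (b - r) ^ 2)) =
          c r * ((b - a) ^ 2 / ((a - r) * (b - r) ^ 2)) := by
        field_simp
        ring
      have h2 := mul_nonneg (hc r hr).1 (show 0 ≤ (b - a) ^ 2 / ((a - r) * (b - r) ^ 2) by positivity)
      linarith
    linarith

end Univariate

section Stable

open MvPolynomial Filter Topology ComplexConjugate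

variable {σ : Type*}

/-- A real polynomial without zeros in the product of open upper half planes. -/
def RealStable (q : MvPolynomial σ ℝ) : Prop :=
  ∀ z : σ → ℂ, (∀ j, 0 < (z j).im) → aeval z q ≠ 0

/-- The logarithmic derivative of `q` in direction `j` at `a`. -/
noncomputable def barrier (q : MvPolynomial σ ℝ) (j : σ) (a : σ → ℝ) : ℝ :=
  eval a (pderiv j q) / eval a q

theorem pderiv_pderiv_comm {R : Type*} [CommRing R] (i j : σ) (p : MvPolynomial σ R) :
    pderiv i (pderiv j p) = pderiv j (pderiv i p) := by
  classical
  have h : ⁅(pderiv i : Derivation R (MvPolynomial σ R) (MvPolynomial σ R)),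
      (pderiv j : Derivation R (MvPolynomial σ R) (MvPolynomial σ R))⁆ = 0 := by
    refine MvPolynomial.derivation_ext (fun k => ?_)
    rw [Derivation.commutator_apply, pderiv_X, pderiv_X, Pi.single_apply, Pi.single_apply]
    split_ifs <;> simp
  exact sub_eq_zero.1 ((Derivation.commutator_apply ..).symm.trans (DFunLike.congr_fun h p))

variable [DecidableEq σ]

/-- The univariate polynomial obtained from `q` by freeing the variable `i` at the point `z`. -/
noncomputable def slice {A : Type*} [CommRing A] [Algebra ℝ A] (q : MvPolynomial σ ℝ) (z : σ → A)
    (i : σ) : Polynomial A :=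
  aeval (Function.update (fun j => Polynomial.C (z j)) i Polynomial.X) q

theorem aeval_slice {A B : Type*} [CommRing A] [Algebra ℝ A] [CommRing B] [Algebra ℝ B]
    [Algebra A B] [IsScalarTower ℝ A B] (q : MvPolynomial σ ℝ) (z : σ → A) (i : σ) (s : B) :
    Polynomial.aeval s (slice q z i) =
      aeval (Function.update (fun j => algebraMap A B (z j)) i s) q := by
  have h : ((Polynomial.aeval s : Polynomial A →ₐ[A] B).restrictScalars ℝ).comp
      (aeval (Function.update (fun j => Polynomial.C (z j)) i Polynomial.X)) =
      aeval (Function.update (fun j => algebraMap A B (z j)) i s) := by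
    refine MvPolynomial.algHom_ext fun j => ?_
    rcases eq_or_ne j i with rfl | hj
    · simp
    · simp [hj]
  exact DFunLike.congr_fun h q

theorem eval_slice {A : Type*} [CommRing A] [Algebra ℝ A] (q : MvPolynomial σ ℝ) (z : σ → A)
    (i : σ) (s : A) : (slice q z i).eval s = aeval (Function.update z i s) q := by
  simpa using aeval_slice q z i s

theorem derivative_slice {A : Type*} [CommRing A] [Algebra ℝ A] (q : MvPolynomial σ ℝ) (z : σ → A)
    (i : σ) : Polynomial.derivative (slice q z i) = slice (pderiv i q) z i := by
  unfold slice
  induction q using MvPolynomial.induction_on with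
  | C c => simp [IsScalarTower.algebraMap_apply ℝ A (Polynomial A)]
  | add p q hp hq => simp only [map_add, hp, hq]
  | mul_X p j hp =>
    rw [map_mul, Polynomial.derivative_mul, hp, Derivation.leibniz]
    rcases eq_or_ne j i with rfl | hj
    · simp; ring
    · simp [hj, mul_comm]

theorem Polynomial.im_derivative_div_eval_neg {v : Polynomial ℂ}
    (hv : ∀ z : ℂ, 0 < z.im → v.eval z ≠ 0) {z : ℂ} (hz : 0 < z.im) :
    v.derivative.eval z = 0 ∨ (v.derivative.eval z / v.eval z).im < 0 := by
  have hsum := (IsAlgClosed.splits v).eval_derivative_div_eval_of_ne_zero (hv z hz)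
  have hroot : ∀ r ∈ v.roots, (1 / (z - r)).im < 0 := fun r hr => by
    have hr0 : r.im ≤ 0 := by
      by_contra! h
      exact hv r h (Polynomial.isRoot_of_mem_roots hr)
    have him : 0 < (z - r).im := by simp; linarith
    have hne : z - r ≠ 0 := by intro h; simp [h] at him
    rw [one_div, Complex.inv_im]
    exact div_neg_of_neg_of_pos (by linarith) (Complex.normSq_pos.2 hne)
  rw [hsum]
  rcases Multiset.empty_or_exists_mem v.roots with h0 | ⟨r, hr⟩
  · left
    rw [h0] at hsum
    simpa [hv z hz] using hsum
  · right
    have : ∀ s : Multiset ℂ, (∀ r ∈ s, (1 / (z - r)).im < 0) →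
        (s.map fun r => 1 / (z - r)).sum.im ≤ 0 := by
      intro s
      induction s using Multiset.induction_on with
      | empty => simp
      | cons a s ih =>
        intro h
        rw [Multiset.map_cons, Multiset.sum_cons, Complex.add_im]
        have h1 := h a (Multiset.mem_cons_self a s)
        have h2 := ih fun r hr => h r (Multiset.mem_cons_of_mem hr)
        linarith
    obtain ⟨s, hs⟩ := Multiset.exists_cons_of_mem hr
    rw [hs] at hroot ⊢
    rw [Multiset.map_cons, Multiset.sum_cons, Complex.add_im]
    have h1 := hroot r (Multiset.mem_cons_self r s)
    have h2 := this s fun r hr => hroot r (Multiset.mem_cons_of_mem hr)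
    linarith

theorem RealStable.im_pderiv_div_neg {q : MvPolynomial σ ℝ} (hq : RealStable q) (i : σ)
    {z : σ → ℂ} (hz : ∀ j, 0 < (z j).im) :
    aeval z (pderiv i q) = 0 ∨ (aeval z (pderiv i q) / aeval z q).im < 0 := by
  have := Polynomial.im_derivative_div_eval_neg (v := slice q z i) (fun s hs => by
    rw [eval_slice]
    refine hq _ fun j => ?_
    rcases eq_or_ne j i with rfl | hj
    · simpa using hs
    · simpa [hj] using hz j) (hz i)
  simpa only [derivative_slice, eval_slice, Function.update_eq_self] using this

theorem RealStable.sub_pderiv {q : MvPolynomial σ ℝ} (hq : RealStable q) (i : σ) :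
    RealStable (q - pderiv i q) := by
  intro z hz h
  rw [map_sub, sub_eq_zero] at h
  rcases hq.im_pderiv_div_neg i hz with h0 | h0
  · exact hq z hz (h.trans h0)
  · rw [← h, div_self (hq z hz)] at h0
    simp at h0

theorem RealStable.im_pderiv_mul_conj_nonpos {q : MvPolynomial σ ℝ} (hq : RealStable q) (i : σ)
    {z : σ → ℂ} (hz : ∀ j, 0 ≤ (z j).im) :
    (aeval z (pderiv i q) * conj (aeval z q)).im ≤ 0 := by
  have hc : ∀ p : MvPolynomial σ ℝ,
      Continuous fun t : ℝ => aeval (fun j => z j + t * Complex.I) p := by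
    intro p
    induction p using MvPolynomial.induction_on with
    | C c => simpa using continuous_const
    | add p q hp hq =>
      simp only [map_add]
      exact hp.add hq
    | mul_X p j hp =>
      simp only [map_mul, aeval_X]
      exact hp.mul (by fun_prop)
  have hcont : Continuous fun t : ℝ => (aeval (fun j => z j + t * Complex.I) (pderiv i q) *
      conj (aeval (fun j => z j + t * Complex.I) q)).im :=
    Complex.continuous_im.comp ((hc (pderiv i q)).mul (Complex.continuous_conj.comp (hc q)))
  have hlim := (hcont.tendsto 0).mono_left (nhdsWithin_le_nhds (s := Set.Ioi 0))
  simp only [Complex.ofReal_zero, zero_mul, add_zero] at hlim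
  refine le_of_tendsto hlim ?_
  filter_upwards [self_mem_nhdsWithin] with t ht
  have hpos : ∀ j, 0 < (z j + t * Complex.I).im := fun j => by
    have := hz j
    have ht : 0 < t := ht
    simp; linarith
  have hne := hq _ hpos
  have h1 : aeval (fun j => z j + t * Complex.I) (pderiv i q) *
      conj (aeval (fun j => z j + t * Complex.I) q) =
      (aeval (fun j => z j + t * Complex.I) (pderiv i q) / aeval (fun j => z j + t * Complex.I) q) *
        ((Complex.normSq (aeval (fun j => z j + t * Complex.I) q) : ℝ) : ℂ) := by
    rw [Complex.normSq_eq_conj_mul_self]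
    field_simp
  rw [h1, Complex.im_mul_ofReal]
  refine mul_nonpos_of_nonpos_of_nonneg ?_ (Complex.normSq_nonneg _)
  rcases hq.im_pderiv_div_neg i hpos with h0 | h0
  · simp [h0]
  · exact h0.le

theorem RealStable.nevanlinnaPair_slice {q : MvPolynomial σ ℝ} (hq : RealStable q) (i j : σ)
    (a : σ → ℝ) : NevanlinnaPair (slice q a i) (slice (pderiv j q) a i) := by
  intro s hs
  rw [aeval_slice, aeval_slice]
  refine hq.im_pderiv_mul_conj_nonpos j fun k => ?_
  rcases eq_or_ne k i with rfl | hk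
  · simpa using hs.le
  · simp [hk]

theorem RealStable.barrier_update {q : MvPolynomial σ ℝ} (hq : RealStable q) (i j : σ)
    {a : σ → ℝ} (hpos : ∀ b, a ≤ b → 0 < eval b q) {t : ℝ} (ht : a i ≤ t) {κ : ℝ} {b : σ → ℝ}
    (hb : b = Function.update a i t)
    (hκ : κ = (eval b (pderiv i (pderiv j q)) * eval b q -
      eval b (pderiv j q) * eval b (pderiv i q)) / eval b q ^ 2) :
    κ ≤ 0 ∧ barrier q j b - (t - a i) * κ ≤ barrier q j a := by
  have hev : ∀ (p : MvPolynomial σ ℝ) (x : ℝ),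
      (slice p a i).eval x = eval (Function.update a i x) p := fun p x => by
    rw [eval_slice]
    rfl
  have := (hq.nevanlinnaPair_slice i j a).deriv_nonpos_and_tangent_le ht (κ := κ) (fun x hx => by
    rw [hev]
    exact (hpos _ (le_update_iff.2 ⟨hx, fun _ _ => le_rfl⟩)).ne') (by
    rw [hκ, derivative_slice, derivative_slice, hev, hev, hev, hev, hb])
  simpa only [hev, ← hb, Function.update_eq_self, barrier] using this

theorem RealStable.barrier_antitone [Fintype σ] {q : MvPolynomial σ ℝ} (hq : RealStable q) (j : σ)
    {a : σ → ℝ} (hpos : ∀ b, a ≤ b → 0 < eval b q) {b : σ → ℝ} (hab : a ≤ b) :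
    barrier q j b ≤ barrier q j a := by
  have key : ∀ S : Finset σ, barrier q j (S.piecewise b a) ≤ barrier q j a := by
    intro S
    induction S using Finset.induction_on with
    | empty => simp
    | insert i S hi ih =>
      refine le_trans ?_ ih
      have hle : a ≤ S.piecewise b a := fun k => by
        by_cases hk : k ∈ S <;> simp [hk, hab k]
      have ht : S.piecewise b a i ≤ b i := by simpa [hi] using hab i
      obtain ⟨h1, h2⟩ := hq.barrier_update i j (fun c hc => hpos c (hle.trans hc)) ht
        (S.piecewise_insert b a i) rfl
      have := mul_nonpos_of_nonneg_of_nonpos (sub_nonneg.2 ht) h1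
      linarith
  simpa using key Finset.univ

/-- Shifting the `i`-th coordinate by `δ` compensates the operator `1 - ∂ᵢ`. -/
theorem RealStable.barrier_sub_pderiv_le [Fintype σ] {q : MvPolynomial σ ℝ} (hq : RealStable q)
    (i : σ) {a : σ → ℝ} (hpos : ∀ b, a ≤ b → 0 < eval b q) {δ : ℝ} (hδ : 0 < δ)
    (hi : barrier q i a ≤ 1 - 1 / δ) {b : σ → ℝ} (hb : b = Function.update a i (a i + δ)) :
    (∀ c, b ≤ c → 0 < eval c (q - pderiv i q)) ∧
      ∀ j, barrier (q - pderiv i q) j b ≤ barrier q j a := by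
  have hab : a ≤ b := by
    rw [hb]; exact le_update_iff.2 ⟨by linarith, fun _ _ => le_rfl⟩
  have hδ1 : 0 < 1 / δ := by positivity
  have hpos' : ∀ c, b ≤ c → 0 < eval c (q - pderiv i q) := fun c hc => by
    have h0 := hpos c (hab.trans hc)
    have h1 : eval c (pderiv i q) / eval c q < 1 := by
      have := hq.barrier_antitone i hpos (hab.trans hc)
      unfold barrier at this hi
      linarith
    rw [div_lt_one h0] at h1
    rw [map_sub]
    linarith
  refine ⟨hpos', fun j => ?_⟩
  obtain ⟨h1, h2⟩ := hq.barrier_update i j hpos (show a i ≤ a i + δ by linarith) hb rfl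
  refine le_trans ?_ h2
  have hi' := (hq.barrier_antitone i hpos hab).trans hi
  have h0 := hpos b hab
  have h3 := hpos' b le_rfl
  have hcomm : eval b (pderiv j (pderiv i q)) = eval b (pderiv i (pderiv j q)) := by
    rw [pderiv_pderiv_comm]
  have hne0 := h0.ne'
  have hne3 := h3.ne'
  unfold barrier at hi' ⊢
  rw [map_sub] at h3 hne3
  simp only [map_sub, hcomm]
  set G := eval b q
  set Gi := eval b (pderiv i q)
  set Gj := eval b (pderiv j q)
  set Gij := eval b (pderiv i (pderiv j q))
  have h4 : (Gj - Gij) / (G - Gi) = Gj / G - G / (G - Gi) * ((Gij * G - Gj * Gi) / G ^ 2) := by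
    field_simp
    ring
  have h5 : G / (G - Gi) ≤ δ := by
    rw [div_le_iff₀ h3]
    rw [div_le_iff₀ h0] at hi'
    have : δ * Gi ≤ δ * ((1 - 1 / δ) * G) := mul_le_mul_of_nonneg_left hi' hδ.le
    have h6 : δ * ((1 - 1 / δ) * G) = δ * G - G := by field_simp
    linarith
  rw [h4, add_sub_cancel_left]
  have := mul_le_mul_of_nonpos_right h5 h1
  linarith

end Stable

section MatrixPencil

open MvPolynomial Matrix

variable {σ n : Type*} [Fintype n] [DecidableEq n]

theorem Matrix.PosSemidef.trace_mul_nonneg {P A : Matrix n n ℂ} (hP : P.PosSemidef)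
    (hA : A.PosSemidef) : 0 ≤ (P * A).trace := by
  obtain ⟨C, rfl⟩ : ∃ C : Matrix n n ℂ, A = Cᴴ * C := by
    open scoped MatrixOrder in
    exact CStarAlgebra.nonneg_iff_eq_star_mul_self.1 hA.nonneg
  rw [← Matrix.mul_assoc, Matrix.trace_mul_comm, ← Matrix.mul_assoc]
  exact (hP.mul_mul_conjTranspose_same C).trace_nonneg

theorem Matrix.PosSemidef.trace_inv_mul_le {N A : Matrix n n ℂ} (hN : N.PosSemidef)
    (hA : A.PosSemidef) {c : ℝ} (hc : 0 < c) :
    (((c : ℂ) • (1 : Matrix n n ℂ) + N)⁻¹ * A).trace ≤ (c : ℂ)⁻¹ * A.trace := by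
  have hcC : (0 : ℂ) < c := by exact_mod_cast hc
  have hM : ((c : ℂ) • (1 : Matrix n n ℂ) + N).PosDef :=
    (Matrix.PosDef.one.smul hcC).add_posSemidef hN
  set M := (c : ℂ) • (1 : Matrix n n ℂ) + N with hMdef
  set B := M⁻¹ with hB
  have hBH : Bᴴ = B := hM.inv.isHermitian
  have hMB : M * B = 1 := Matrix.mul_nonsing_inv _ ((Matrix.isUnit_iff_isUnit_det _).1 hM.isUnit)
  have hBM : B * M = 1 := Matrix.nonsing_inv_mul _ ((Matrix.isUnit_iff_isUnit_det _).1 hM.isUnit)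
  have h1 : (B * N * Bᴴ + (c : ℂ)⁻¹ • ((N * B)ᴴ * (N * B))).PosSemidef :=
    (hN.mul_mul_conjTranspose_same B).add
      ((posSemidef_conjTranspose_mul_self (N * B)).smul (inv_nonneg.2 hcC.le))
  have hN' : N = M - (c : ℂ) • 1 := by rw [hMdef]; abel
  have h2 : B * N * Bᴴ + (c : ℂ)⁻¹ • ((N * B)ᴴ * (N * B)) = (c : ℂ)⁻¹ • 1 - B := by
    have hBN : B * N = 1 - (c : ℂ) • B := by
      rw [hN', Matrix.mul_sub, hBM, Matrix.mul_smul, Matrix.mul_one]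
    have hNB : N * B = 1 - (c : ℂ) • B := by
      rw [hN', Matrix.sub_mul, hMB, Matrix.smul_mul, Matrix.one_mul]
    rw [hBN, hNB, hBH, Matrix.conjTranspose_sub, Matrix.conjTranspose_smul, hBH]
    simp only [conjTranspose_one, Complex.star_def, Complex.conj_ofReal, Matrix.sub_mul,
      Matrix.mul_sub, Matrix.one_mul, Matrix.mul_one, Matrix.smul_mul, Matrix.mul_smul, smul_sub,
      smul_smul]
    have : (c : ℂ)⁻¹ * c = 1 := inv_mul_cancel₀ hcC.ne'
    rw [← mul_assoc, this, one_mul, one_smul]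
    abel
  have h3 := (h2 ▸ h1).trace_mul_nonneg hA
  rw [Matrix.sub_mul, Matrix.trace_sub, Matrix.smul_mul, Matrix.one_mul, Matrix.trace_smul,
    smul_eq_mul, sub_nonneg] at h3
  exact h3

theorem exists_posSemidef_pencil_eq {n : Type*} [DecidableEq n] [Fintype σ] {x t : ℝ}
    {A : σ → Matrix n n ℂ} (ht : 0 ≤ t) (hA : ∀ j, (A j).PosSemidef)
    (hsum : (1 - ∑ j, A j).PosSemidef) {b : σ → ℝ} (hb : ∀ j, -t ≤ b j) :
    ∃ N : Matrix n n ℂ, N.PosSemidef ∧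
      (x : ℂ) • (1 : Matrix n n ℂ) + ∑ j, (b j : ℂ) • A j = ((x - t : ℝ) : ℂ) • 1 + N := by
  refine ⟨(t : ℂ) • (1 - ∑ j, A j) + ∑ j, ((b j + t : ℝ) : ℂ) • A j, ?_, ?_⟩
  · refine (hsum.smul (by exact_mod_cast ht)).add (posSemidef_sum _ fun j _ => (hA j).smul ?_)
    exact_mod_cast by linarith [hb j]
  · push_cast
    simp only [add_smul, sub_smul, smul_sub, Finset.sum_add_distrib, Finset.smul_sum]
    abel

/-- `p` is the polynomial `det (x I + ∑ zⱼ Aⱼ)`. -/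
def IsPencilDet [Fintype σ] (p : MvPolynomial σ ℝ) (x : ℝ) (A : σ → Matrix n n ℂ) : Prop :=
  ∀ z : σ → ℂ, aeval z p = ((x : ℂ) • (1 : Matrix n n ℂ) + ∑ j, z j • A j).det

theorem ofReal_eval (p : MvPolynomial σ ℝ) (b : σ → ℝ) :
    ((eval b p : ℝ) : ℂ) = aeval (fun j => (b j : ℂ)) p :=
  (MvPolynomial.aeval_algebraMap_apply (B := ℂ) b p).symm

namespace IsPencilDet

variable [Fintype σ] {p : MvPolynomial σ ℝ} {x : ℝ} {A : σ → Matrix n n ℂ}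

theorem realStable (hp : IsPencilDet p x A) (hx : 0 < x) (hA : ∀ j, (A j).PosSemidef) :
    RealStable p := by
  intro z hz h
  rw [hp z] at h
  obtain ⟨v, hv, hMv⟩ := Matrix.exists_mulVec_eq_zero_iff.2 h
  have h1 : star v ⬝ᵥ (((x : ℂ) • (1 : Matrix n n ℂ) + ∑ j, z j • A j) *ᵥ v) = 0 := by
    rw [hMv, dotProduct_zero]
  rw [Matrix.add_mulVec, dotProduct_add, Matrix.smul_mulVec, Matrix.one_mulVec, dotProduct_smul,
    Matrix.sum_mulVec, dotProduct_sum] at h1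
  simp only [Matrix.smul_mulVec, dotProduct_smul, smul_eq_mul] at h1
  have hα : ∀ j, 0 ≤ star v ⬝ᵥ (A j *ᵥ v) := fun j => (hA j).dotProduct_mulVec_nonneg v
  have hβ : 0 < star v ⬝ᵥ v := dotProduct_star_self_pos_iff.2 hv
  have him : ∑ j, (z j).im * (star v ⬝ᵥ (A j *ᵥ v)).re = 0 := by
    have := congrArg Complex.im h1
    simpa [Complex.add_im, Complex.mul_im, ← (Complex.le_def.1 (hα _)).2,
      ← (Complex.lt_def.1 hβ).2] using this
  have hz0 : ∀ j, star v ⬝ᵥ (A j *ᵥ v) = 0 := by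
    have hre : ∀ j, 0 ≤ (star v ⬝ᵥ (A j *ᵥ v)).re := fun j => (Complex.le_def.1 (hα j)).1
    have := (Finset.sum_eq_zero_iff_of_nonneg
      (fun j _ => mul_nonneg (hz j).le (hre j))).1 him
    intro j
    have hj := (mul_eq_zero.1 (this j (Finset.mem_univ j))).resolve_left (hz j).ne'
    exact Complex.ext hj (Complex.le_def.1 (hα j)).2.symm
  simp only [hz0, mul_zero, Finset.sum_const_zero, add_zero, mul_eq_zero] at h1
  rcases h1 with h1 | h1
  · exact hx.ne' (by exact_mod_cast h1)
  · exact hβ.ne' h1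

theorem eval_pos (hp : IsPencilDet p x A) {b : σ → ℝ}
    (hb : ((x : ℂ) • (1 : Matrix n n ℂ) + ∑ j, (b j : ℂ) • A j).PosDef) : 0 < eval b p := by
  have := hb.det_pos
  rw [← hp, ← ofReal_eval] at this
  exact_mod_cast this

theorem barrier_eq (hp : IsPencilDet p x A) [DecidableEq σ] {b : σ → ℝ}
    (hb : ((x : ℂ) • (1 : Matrix n n ℂ) + ∑ j, (b j : ℂ) • A j).PosDef) (i : σ) :
    ((barrier p i b : ℝ) : ℂ) =
      (((x : ℂ) • (1 : Matrix n n ℂ) + ∑ j, (b j : ℂ) • A j)⁻¹ * A i).trace := by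
  have hev := ofReal_eval p b
  rw [hp] at hev
  set M := (x : ℂ) • (1 : Matrix n n ℂ) + ∑ j, (b j : ℂ) • A j with hM
  have hMM : M * M⁻¹ = 1 := Matrix.mul_nonsing_inv _ ((Matrix.isUnit_iff_isUnit_det _).1 hb.isUnit)
  have hline : ∀ s : ℂ, (slice p (fun j => (b j : ℂ)) i).eval (s + b i) =
      M.det * (1 + s • (M⁻¹ * A i)).det := by
    intro s
    rw [eval_slice, hp, ← Matrix.det_mul, Matrix.mul_add, Matrix.mul_one, Matrix.mul_smul,
      ← Matrix.mul_assoc, hMM, Matrix.one_mul, hM, add_assoc]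
    congr 2
    rw [← Finset.add_sum_erase _ _ (Finset.mem_univ i),
      ← Finset.add_sum_erase _ (fun j => (b j : ℂ) • A j) (Finset.mem_univ i)]
    rw [Finset.sum_congr rfl (g := fun j => (b j : ℂ) • A j) fun j hj => by
      rw [Function.update_of_ne (Finset.ne_of_mem_erase hj)]]
    rw [Function.update_self, add_smul]
    abel
  have hpoly : (slice p (fun j => (b j : ℂ)) i).comp (Polynomial.X + Polynomial.C (b i : ℂ)) =
      Polynomial.C M.det *
        (1 + (Polynomial.X : Polynomial ℂ) • (M⁻¹ * A i).map Polynomial.C).det := by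
    refine Polynomial.funext fun s => ?_
    rw [Polynomial.eval_comp, Polynomial.eval_add, Polynomial.eval_X, Polynomial.eval_C, hline,
      Polynomial.eval_mul, Polynomial.eval_C, ← Polynomial.coe_evalRingHom, RingHom.map_det]
    congr 2
    generalize M⁻¹ * A i = Q
    ext k l
    by_cases hkl : k = l <;> simp [hkl, mul_comm s]
  have hder := congrArg (fun r => (Polynomial.derivative r).eval 0) hpoly
  simp only [Polynomial.derivative_comp, Polynomial.derivative_C_mul, Polynomial.eval_mul,
    Polynomial.eval_C, Matrix.derivative_det_one_add_X_smul] at hder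
  simp only [Polynomial.derivative_add, Polynomial.derivative_X, Polynomial.derivative_C, add_zero,
    Polynomial.eval_one, one_mul, Polynomial.eval_comp, Polynomial.eval_add, Polynomial.eval_X,
    Polynomial.eval_C, zero_add, derivative_slice, eval_slice] at hder
  have hupd : Function.update (fun j => (b j : ℂ)) i (b i) = fun j => (b j : ℂ) :=
    Function.update_eq_self i (fun j => (b j : ℂ))
  rw [hupd] at hder
  rw [barrier, Complex.ofReal_div, hev, ofReal_eval, hder]
  exact mul_div_cancel_left₀ _ hb.det_pos.ne'

end IsPencilDet

end MatrixPencil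

section MixedCharPoly

open MvPolynomial

variable {σ n : Type*}

theorem map_foldr_sub_pderiv {R S : Type*} [CommRing R] [CommRing S] (φ : R →+* S) (L : List σ)
    (p : MvPolynomial σ R) :
    map φ (L.foldr (fun i q => q - pderiv i q) p) =
      L.foldr (fun i q => q - pderiv i q) (map φ p) := by
  induction L with
  | nil => rfl
  | cons i L ih => simp only [List.foldr_cons, map_sub, ← pderiv_map, ih]

theorem exists_isPencilDet [Fintype σ] [Fintype n] [DecidableEq n] (x : ℝ) {A : σ → Matrix n n ℂ}
    (hA : ∀ j, (A j).IsHermitian) :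
    ∃ p : MvPolynomial σ ℝ, IsPencilDet p x A ∧ map (algebraMap ℝ ℂ) p =
      ((C (x : ℂ) : MvPolynomial σ ℂ) • (1 : Matrix n n (MvPolynomial σ ℂ)) +
        ∑ j, (X j : MvPolynomial σ ℂ) • (A j).map C).det := by
  set P := ((C (x : ℂ) : MvPolynomial σ ℂ) • (1 : Matrix n n (MvPolynomial σ ℂ)) +
        ∑ j, (X j : MvPolynomial σ ℂ) • (A j).map C).det with hP
  have hconj : map (starRingEnd ℂ) P = P := by
    rw [hP, RingHom.map_det, ← Matrix.det_transpose]
    congr 1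
    ext1 k l
    have h : ∀ j, starRingEnd ℂ (A j l k) = A j k l := fun j => (hA j).apply k l
    rcases eq_or_ne k l with rfl | hkl
    · simp [Matrix.sum_apply, h]
    · simp [Matrix.sum_apply, h, hkl, hkl.symm]
  obtain ⟨p, hp⟩ : P ∈ Set.range (map (algebraMap ℝ ℂ)) := by
    rw [MvPolynomial.mem_range_map_iff_coeffs_subset]
    intro c hc
    obtain ⟨k, -, rfl⟩ := MvPolynomial.mem_coeffs_iff.1 hc
    refine ⟨(coeff k P).re, Complex.conj_eq_iff_re.1 ?_⟩
    rw [← coeff_map, hconj]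
  refine ⟨p, fun z => ?_, hp⟩
  rw [aeval_def, ← eval_map, hp, hP, RingHom.map_det]
  congr 1
  ext k l
  by_cases hkl : k = l <;> simp [Matrix.sum_apply, hkl]

theorem RealStable.foldr_sub_pderiv [Fintype σ] [DecidableEq σ] {p : MvPolynomial σ ℝ}
    (hp : RealStable p) {t : ℝ} (ht : 0 < t) (hpos : ∀ b, (fun _ => -t) ≤ b → 0 < eval b p)
    (hbar : ∀ j, barrier p j (fun _ => -t) ≤ 1 - 1 / t) {L : List σ} (hL : L.Nodup) :
    RealStable (L.foldr (fun i q => q - pderiv i q) p) ∧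
      (∀ b, (fun j => if j ∈ L then 0 else -t) ≤ b →
        0 < eval b (L.foldr (fun i q => q - pderiv i q) p)) ∧
      ∀ j ∉ L, barrier (L.foldr (fun i q => q - pderiv i q) p) j
        (fun j => if j ∈ L then 0 else -t) ≤ 1 - 1 / t := by
  induction L with
  | nil => exact ⟨hp, by simpa using hpos, by simpa using hbar⟩
  | cons i L ih =>
    obtain ⟨hi, hL⟩ := List.nodup_cons.1 hL
    obtain ⟨h1, h2, h3⟩ := ih hL
    have hupd : (fun j => if j ∈ i :: L then 0 else -t) =
        Function.update (fun j => if j ∈ L then 0 else -t) i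
          ((fun j => if j ∈ L then 0 else -t) i + t) := by
      ext j
      rcases eq_or_ne j i with rfl | hj
      · simp [hi]
      · simp [hj]
    obtain ⟨h4, h5⟩ := h1.barrier_sub_pderiv_le i h2 ht (h3 i hi) hupd
    exact ⟨h1.sub_pderiv i, h4, fun j hj => (h5 j).trans (h3 j (List.not_mem_of_not_mem_cons hj))⟩

end MixedCharPoly

open MvPolynomial in
theorem mixed_char_poly_eval_pos {d m : ℕ} {ε : ℝ} (hε : 0 ≤ ε)
    {A : Fin m → Matrix (Fin d) (Fin d) ℂ} (hA : ∀ i, (A i).PosSemidef)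
    (hsum : ((1 : Matrix (Fin d) (Fin d) ℂ) - ∑ i, A i).PosSemidef)
    (htr : ∀ i, (A i).trace ≤ (ε : ℂ)) {x : ℝ} (hx : (1 + Real.sqrt ε) ^ 2 < x) :
    0 < Polynomial.eval (x : ℂ) (MvPolynomial.eval (0 : Fin m → Polynomial ℂ)
        ((List.finRange m).foldr (fun i q => q - MvPolynomial.pderiv i q)
          (Matrix.det
            ((MvPolynomial.C Polynomial.X : MvPolynomial (Fin m) (Polynomial ℂ)) •
                (1 : Matrix (Fin d) (Fin d) (MvPolynomial (Fin m) (Polynomial ℂ)))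
              + ∑ i, (MvPolynomial.X i : MvPolynomial (Fin m) (Polynomial ℂ)) •
                  (A i).map (fun a => MvPolynomial.C (Polynomial.C a)))))) := by
  obtain ⟨p, hp, hmap⟩ := exists_isPencilDet x fun i => (hA i).isHermitian
  have hs := Real.sqrt_nonneg ε
  have hsq := Real.sq_sqrt hε
  set t := 1 + Real.sqrt ε with ht
  have ht0 : 0 < t := by positivity
  have hxt : 0 < x - t := by nlinarith
  have hpd : ∀ b : Fin m → ℝ, (fun _ => -t) ≤ b →
      ((x : ℂ) • (1 : Matrix (Fin d) (Fin d) ℂ) + ∑ j, (b j : ℂ) • A j).PosDef := fun b hb => by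
    obtain ⟨N, hN, hMN⟩ := exists_posSemidef_pencil_eq (x := x) ht0.le hA hsum hb
    rw [hMN]
    exact (Matrix.PosDef.one.smul (by exact_mod_cast hxt)).add_posSemidef hN
  have hbar : ∀ j, barrier p j (fun _ => -t) ≤ 1 - 1 / t := fun j => by
    obtain ⟨N, hN, hMN⟩ := exists_posSemidef_pencil_eq (x := x) ht0.le hA hsum
      (b := fun _ => -t) fun _ => le_rfl
    have h1 := hp.barrier_eq (hpd (fun _ => -t) le_rfl) j
    rw [hMN] at h1
    have h2 := (hN.trace_inv_mul_le (hA j) hxt).trans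
      (mul_le_mul_of_nonneg_left (htr j) (by exact_mod_cast (inv_pos.2 hxt).le))
    rw [← h1] at h2
    have h3 : barrier p j (fun _ => -t) ≤ (x - t)⁻¹ * ε := by exact_mod_cast h2
    refine h3.trans ?_
    have h4 : 1 - 1 / t = Real.sqrt ε / t := by rw [ht]; field_simp; ring
    rw [h4, inv_mul_eq_div, div_le_div_iff₀ hxt ht0]
    nlinarith
  obtain ⟨-, h, -⟩ := (hp.realStable (by linarith) hA).foldr_sub_pderiv ht0
    (fun b hb => hp.eval_pos (hpd b hb)) hbar (List.nodup_finRange m)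
  have h0 := h 0 fun j => by simp
  rw [← Polynomial.coe_evalRingHom, MvPolynomial.map_eval, map_foldr_sub_pderiv, RingHom.map_det]
  have hM : (MvPolynomial.map (Polynomial.evalRingHom (x : ℂ))).mapMatrix
      ((C Polynomial.X : MvPolynomial (Fin m) (Polynomial ℂ)) •
          (1 : Matrix (Fin d) (Fin d) (MvPolynomial (Fin m) (Polynomial ℂ))) +
        ∑ i, (X i : MvPolynomial (Fin m) (Polynomial ℂ)) •
          (A i).map (fun a => C (Polynomial.C a))) =
      (C (x : ℂ) : MvPolynomial (Fin m) ℂ) • (1 : Matrix (Fin d) (Fin d) (MvPolynomial (Fin m) ℂ)) +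
        ∑ j, (X j : MvPolynomial (Fin m) ℂ) • (A j).map C := by
    ext1 k l
    by_cases hkl : k = l <;> simp [Matrix.sum_apply, hkl]
  have hz : (Polynomial.evalRingHom (x : ℂ) ∘ (0 : Fin m → Polynomial ℂ)) =
      algebraMap ℝ ℂ ∘ (0 : Fin m → ℝ) := by
    ext; simp
  rw [hM, ← hmap, ← map_foldr_sub_pderiv, hz, ← MvPolynomial.map_eval, Complex.coe_algebraMap]
  exact_mod_cast h0

open MvPolynomial in
/-- **Largest root of the mixed characteristic polynomial.**  Let
`A₁, …, Aₘ` be Hermitian positive semidefinite `d × d` complex matrices with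
`∑ Aᵢ ≤ I` and `Tr Aᵢ ≤ ε`.  Form the multivariate polynomial
`P = det(x I + ∑ zᵢ Aᵢ)` (a polynomial in `z₁, …, zₘ` with coefficients in
`ℂ[x]`), apply the operators `(1 - ∂_{zᵢ})` successively, and set
`z₁ = ⋯ = zₘ = 0`, obtaining the mixed characteristic polynomial `μ ∈ ℂ[x]`.
Then every real root of `μ` is at most `(1 + √ε)²`; equivalently, `μ(x) > 0`
(a positive real number) for every real `x > (1 + √ε)²`. -/
theorem mixed_char_poly_largest_root_le (d m : ℕ) (ε : ℝ) (hε : 0 ≤ ε)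
    (A : Fin m → Matrix (Fin d) (Fin d) ℂ)
    (hA : ∀ i, (A i).PosSemidef)
    (hsum : ((1 : Matrix (Fin d) (Fin d) ℂ) - ∑ i, A i).PosSemidef)
    (htr : ∀ i, (A i).trace ≤ (ε : ℂ))
    (μ : Polynomial ℂ)
    (hμ : μ = MvPolynomial.eval (0 : Fin m → Polynomial ℂ)
        ((List.finRange m).foldr (fun i q => q - MvPolynomial.pderiv i q)
          (Matrix.det
            ((MvPolynomial.C Polynomial.X : MvPolynomial (Fin m) (Polynomial ℂ)) •
                (1 : Matrix (Fin d) (Fin d) (MvPolynomial (Fin m) (Polynomial ℂ)))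
              + ∑ i, (MvPolynomial.X i : MvPolynomial (Fin m) (Polynomial ℂ)) •
                  (A i).map (fun a => MvPolynomial.C (Polynomial.C a)))))) :
    (∀ x : ℝ, Polynomial.eval (x : ℂ) μ = 0 → x ≤ (1 + Real.sqrt ε) ^ 2) ∧
    (∀ x : ℝ, (1 + Real.sqrt ε) ^ 2 < x → 0 < Polynomial.eval (x : ℂ) μ) := by
  subst hμ
  have key := fun (x : ℝ) => mixed_char_poly_eval_pos hε hA hsum htr (x := x)
  refine ⟨fun x hx => ?_, key⟩
  by_contra! h
  exact (key x h).ne' hx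
end

section
/- Let $A_1, \ldots, A_m$ be $d\times d$ Hermitian positive semidefinite matrices. Then the polynomial $P(x, z_1, \ldots, z_m) = \det\!\left(xI_d + \sum_{i=1}^{m} z_i A_i\right)$, regarded as a polynomial with real coefficients in the variables $x, z_1, \ldots, z_m$, is real stable: it has no zero $(x, z_1, \ldots, z_m) \in \mathbb{C}^{m+1}$ in which every coordinate has strictly positive imaginary part. -/
open scoped ComplexOrder

open Matrix in
/-- The determinant of a matrix pencil with Hermitian coefficients has real coefficients. -/
theorem MvPolynomial.map_star_det_pencil {n ι : Type*} [Fintype n] [DecidableEq n] [Fintype ι]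
    {σ : Type*} (x : σ) (z : ι → σ) (A : ι → Matrix n n ℂ) (hA : ∀ i, (A i).IsHermitian) :
    MvPolynomial.map (starRingEnd ℂ)
      (((X x : MvPolynomial σ ℂ) • (1 : Matrix n n (MvPolynomial σ ℂ)) +
        ∑ i, (X (z i) : MvPolynomial σ ℂ) • (A i).map C).det) =
      ((X x : MvPolynomial σ ℂ) • (1 : Matrix n n (MvPolynomial σ ℂ)) +
        ∑ i, (X (z i) : MvPolynomial σ ℂ) • (A i).map C).det := by
  rw [RingHom.map_det, ← det_transpose]
  congr 1
  ext1 j k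
  have hconj (i : ι) : (starRingEnd ℂ) (A i k j) = A i j k := (hA i).apply j k
  simp [Matrix.sum_apply, Matrix.one_apply, hconj, eq_comm, apply_ite]

open Matrix in
/-- A pencil of positive semidefinite matrices is nonsingular when the coefficient of the identity
lies in the open upper half-plane and the others lie in its closure. -/
theorem Matrix.det_pencil_ne_zero {n ι : Type*} [Fintype n] [DecidableEq n] [Fintype ι]
    (A : ι → Matrix n n ℂ) (hA : ∀ i, (A i).PosSemidef) {x : ℂ} {z : ι → ℂ}
    (hx : 0 < x.im) (hz : ∀ i, 0 ≤ (z i).im) :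
    (x • (1 : Matrix n n ℂ) + ∑ i, z i • A i).det ≠ 0 := by
  intro hdet
  obtain ⟨v, hv, hMv⟩ := exists_mulVec_eq_zero_iff.mpr hdet
  have hform : x * (star v ⬝ᵥ v) + ∑ i, z i * (star v ⬝ᵥ A i *ᵥ v) = 0 := by
    have := congrArg (star v ⬝ᵥ ·) hMv
    simpa [add_mulVec, sum_mulVec, smul_mulVec, dotProduct_add, dotProduct_sum,
      dotProduct_smul] using this
  have hnorm : 0 < star v ⬝ᵥ v := dotProduct_star_self_pos_iff.mpr hv
  have him := congrArg Complex.im hform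
  have hpos : 0 < x.im * (star v ⬝ᵥ v).re := mul_pos hx (Complex.lt_def.mp hnorm).1
  have hnonneg : 0 ≤ ∑ i, (z i).im * (star v ⬝ᵥ A i *ᵥ v).re :=
    Finset.sum_nonneg fun i _ ↦
      mul_nonneg (hz i) (Complex.le_def.mp ((hA i).dotProduct_mulVec_nonneg v)).1
  have hvim : (star v ⬝ᵥ v).im = 0 := (Complex.lt_def.mp hnorm).2.symm
  have hAim (i : ι) : (star v ⬝ᵥ A i *ᵥ v).im = 0 :=
    (Complex.le_def.mp ((hA i).dotProduct_mulVec_nonneg v)).2.symm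
  simp only [Complex.add_im, Complex.im_sum, Complex.mul_im, hvim, hAim, mul_zero, zero_add,
    Complex.zero_im] at him
  linarith

/-- **Real stability of the determinantal polynomial.**  Let `A₁, …, Aₘ` be
Hermitian positive semidefinite `d × d` complex matrices and let
`P = det(x I + ∑ zᵢ Aᵢ)`, a polynomial in the `m + 1` variables
`x = X 0, z₁ = X 1, …, zₘ = X m`.  Then `P` has real coefficients, and `P` is
real stable: it does not vanish at any point of `ℂ^(m+1)` all of whose
coordinates have strictly positive imaginary part. -/
theorem det_poly_real_stable (d m : ℕ)
    (A : Fin m → Matrix (Fin d) (Fin d) ℂ)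
    (hA : ∀ i, (A i).PosSemidef)
    (P : MvPolynomial (Fin (m + 1)) ℂ)
    (hP : P = Matrix.det
        ((MvPolynomial.X 0 : MvPolynomial (Fin (m + 1)) ℂ) •
            (1 : Matrix (Fin d) (Fin d) (MvPolynomial (Fin (m + 1)) ℂ))
          + ∑ i : Fin m, (MvPolynomial.X i.succ : MvPolynomial (Fin (m + 1)) ℂ) •
              (A i).map MvPolynomial.C)) :
    (∀ s : Fin (m + 1) →₀ ℕ, (P.coeff s).im = 0) ∧
    (∀ w : Fin (m + 1) → ℂ, (∀ k, 0 < (w k).im) → MvPolynomial.eval w P ≠ 0) := by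
  subst hP
  refine ⟨fun s ↦ ?_, fun w hw ↦ ?_⟩
  · rw [← Complex.conj_eq_iff_im, ← MvPolynomial.coeff_map,
      MvPolynomial.map_star_det_pencil 0 Fin.succ A fun i ↦ (hA i).isHermitian]
  · rw [RingHom.map_det]
    convert Matrix.det_pencil_ne_zero A hA (hw 0) fun i : Fin m ↦ (hw i.succ).le using 2
    ext j k
    simp [Matrix.sum_apply, Matrix.one_apply, apply_ite]
end

section
/- Let $v_1, \ldots, v_m$ be independent random vectors in $\mathbb{C}^d$, each with finite support. Then the expected characteristic polynomial satisfies the identity $\mathbb{E}\,\det\!\left(xI_d - \sum_{i=1}^{m} v_i v_i^{\ast}\right) = \prod_{i=1}^{m}(1-\partial_{z_i})\,\det\!\left(xI_d + \sum_{i=1}^{m} z_i\, \mathbb{E}[v_i v_i^{\ast}]\right)\Big|_{z_1=\cdots=z_m=0}$, as polynomials in $x$. -/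
open Finset in
/-- The Leibniz rule for finite products. -/
theorem Derivation.map_finset_prod {K R ι : Type*} [CommRing K] [CommRing R] [Algebra K R]
    [DecidableEq ι] (D : Derivation K R R) (s : Finset ι) (f : ι → R) :
    D (∏ i ∈ s, f i) = ∑ i ∈ s, D (f i) * ∏ j ∈ s.erase i, f j := by
  induction s using Finset.induction_on with
  | empty => simp
  | insert a s ha ih =>
    rw [prod_insert ha, D.leibniz, ih, sum_insert ha, erase_insert ha, smul_eq_mul, smul_eq_mul,
      add_comm, mul_comm, mul_sum]
    congr 1
    refine sum_congr rfl fun i hi => ?_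
    have hia : a ≠ i := fun h => ha (h ▸ hi)
    rw [erase_insert_of_ne hia, prod_insert (fun h => ha (mem_of_mem_erase h))]
    ring

namespace Matrix

variable {n : Type*} [Fintype n] [DecidableEq n]

/-- Jacobi's formula for a derivation: differentiate the rows one at a time. -/
theorem derivation_det {K R : Type*} [CommRing K] [CommRing R] [Algebra K R]
    (D : Derivation K R R) (M : Matrix n n R) :
    D M.det = ∑ i, (M.updateRow i fun j => D (M i j)).det := by
  have expand (N : Matrix n n R) :
      N.det = ∑ σ : Equiv.Perm n, Equiv.Perm.sign σ • ∏ i, N i (σ i) := by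
    rw [← det_transpose, det_apply]
    rfl
  simp_rw [expand]
  rw [Finset.sum_comm, map_sum]
  refine Finset.sum_congr rfl fun σ _ => ?_
  rw [Units.smul_def, map_zsmul, D.map_finset_prod, Finset.smul_sum]
  refine Finset.sum_congr rfl fun i _ => ?_
  rw [Units.smul_def, ← Finset.mul_prod_erase _ _ (Finset.mem_univ i), updateRow_self]
  congr 2
  refine Finset.prod_congr rfl fun j hj => ?_
  rw [updateRow_ne (Finset.ne_of_mem_erase hj)]

/-- The determinant is affine along a rank-one perturbation. -/
theorem det_add_vecMulVec_eq_sum {R : Type*} [CommRing R] (M : Matrix n n R) (a b : n → R) :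
    (M + vecMulVec a b).det = M.det + ∑ i, (M.updateRow i (vecMulVec a b i)).det := by
  have expand (x h : n → n → R) :=
    (detRowAlternating (R := R) (n := n)).toMultilinearMap.map_add_eq_map_add_linearDeriv_add x h
  simp_rw [MultilinearMap.linearDeriv_apply] at expand
  refine (expand M (vecMulVec a b)).trans (add_eq_left.mpr (Finset.sum_eq_zero fun s hs => ?_))
  obtain ⟨i, hi, j, hj, hij⟩ := Finset.one_lt_card.mp (Finset.mem_filter.mp hs).2
  set N : Matrix n n R := s.piecewise (vecMulVec a b) M
  have hNi : N i = a i • b := Finset.piecewise_eq_of_mem _ _ _ hi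
  have hNj : N j = a j • b := Finset.piecewise_eq_of_mem _ _ _ hj
  change N.det = 0
  rw [← updateRow_eq_self N i, hNi, det_updateRow_smul, ← updateRow_eq_self (N.updateRow i b) j,
    updateRow_ne hij.symm, hNj, det_updateRow_smul]
  rw [det_zero_of_row_eq hij, mul_zero, mul_zero]
  rw [updateRow_self, updateRow_ne hij, updateRow_self]

theorem det_sub_vecMulVec_eq_sum {R : Type*} [CommRing R] (M : Matrix n n R) (a b : n → R) :
    (M - vecMulVec a b).det = M.det - ∑ i, (M.updateRow i (vecMulVec a b i)).det := by
  have h := det_add_vecMulVec_eq_sum M (-a) b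
  rw [neg_vecMulVec, ← sub_eq_add_neg] at h
  rw [h, sub_eq_add_neg, ← Finset.sum_neg_distrib]
  congr 1
  refine Finset.sum_congr rfl fun i _ => ?_
  have : (-vecMulVec a b) i = (-1 : R) • vecMulVec a b i := (neg_one_smul R _).symm
  rw [this, det_updateRow_smul, neg_one_mul]

/-- If a derivation sends `M` entrywise to the mean of random rank-one matrices, then `1 - D`
replaces `det M` by the expected determinant of the perturbed matrix. -/
theorem det_sub_derivation_det {K R Ω : Type*} [CommRing K] [CommRing R] [Algebra K R] [Fintype Ω]
    (D : Derivation K R R) (p : Ω → K) (hp : ∑ ω, p ω = 1) (a b : Ω → n → R) (M : Matrix n n R)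
    (hM : ∀ i j, D (M i j) = ∑ ω, p ω • (a ω i * b ω j)) :
    M.det - D M.det = ∑ ω, p ω • (M - vecMulVec (a ω) (b ω)).det := by
  simp_rw [det_sub_vecMulVec_eq_sum, smul_sub, Finset.sum_sub_distrib, ← Finset.sum_smul, hp,
    one_smul, Finset.smul_sum]
  rw [Finset.sum_comm, derivation_det]
  congr 1
  refine Finset.sum_congr rfl fun i _ => ?_
  have hrow : (fun j => D (M i j)) = ∑ ω, p ω • vecMulVec (a ω) (b ω) i := by
    ext j
    simp [hM, vecMulVec_apply]
  rw [hrow]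
  let L : (n → R) →ₗ[R] R := (detRowAlternating (R := R) (n := n)).toMultilinearMap.toLinearMap M i
  change L _ = ∑ ω, p ω • L _
  simp_rw [map_sum, LinearMap.map_smul_of_tower]

/-- Applying `1 - D i` successively for independent random rank-one matrices `a i * b i` turns
`det M` into an expected determinant. -/
theorem foldr_sub_derivation_det {K R : Type*} [CommRing K] [CommRing R] [Algebra K R] {m : ℕ}
    (Ω : Fin m → Type*) [∀ i, Fintype (Ω i)] (D : Fin m → Derivation K R R)
    (p : ∀ i, Ω i → K) (hp : ∀ i, ∑ ω, p i ω = 1) (a b : ∀ i, Ω i → n → K) (M : Matrix n n R)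
    (hM : ∀ i j k, D i (M j k) = ∑ ω, p i ω • algebraMap K R (a i ω j * b i ω k)) :
    (List.finRange m).foldr (fun i q => q - D i q) M.det =
      ∑ ω : ∀ i, Ω i, (∏ i, p i (ω i)) •
        (M - ∑ i, (vecMulVec (a i (ω i)) (b i (ω i))).map (algebraMap K R)).det := by
  induction m with
  | zero => simp
  | succ m ih =>
    rw [List.finRange_succ, List.foldr_cons, List.foldr_map,
      ih (fun i => Ω i.succ) (fun i => D i.succ) (fun i => p i.succ) (fun i => hp i.succ)
        (fun i => a i.succ) (fun i => b i.succ) (fun i => hM i.succ),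
      ← (Fin.consEquiv Ω).sum_comp, Fintype.sum_prod_type_right, map_sum,
      ← Finset.sum_sub_distrib]
    refine Finset.sum_congr rfl fun ω _ => ?_
    rw [(D 0).map_smul, ← smul_sub, det_sub_derivation_det (D 0) (p 0) (hp 0)
      (fun η j => algebraMap K R (a 0 η j)) (fun η j => algebraMap K R (b 0 η j)),
      Finset.smul_sum]
    · refine Finset.sum_congr rfl fun η _ => ?_
      have hmap : vecMulVec (fun j => algebraMap K R (a 0 η j)) (fun j => algebraMap K R (b 0 η j))
          = (vecMulVec (a 0 η) (b 0 η)).map (algebraMap K R) := by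
        ext
        simp [vecMulVec_apply]
      simp [Fin.consEquiv, Fin.prod_univ_succ, Fin.sum_univ_succ, smul_smul, hmap, mul_comm,
        sub_sub, add_comm]
    · intro j k
      simp [hM, sum_apply]

end Matrix


/-- **Expected characteristic polynomial as a mixed characteristic polynomial
(MSS Theorem 4.1).**  Let `v₁, …, vₘ` be independent random vectors in `ℂ^d`
with finite support, modelled by finite sample spaces `Ω i` with probability
weights `p i` (the joint distribution on `∀ i, Ω i` being the product
distribution, which encodes independence).  Then
`E det(x I - ∑ vᵢvᵢ*) = ∏ᵢ (1 - ∂_{zᵢ}) det(x I + ∑ zᵢ E[vᵢvᵢ*]) |_{z = 0}`,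
an identity of polynomials in `x`. -/
theorem expected_charpoly_eq_mixed_char (d m : ℕ)
    (Ω : Fin m → Type) [∀ i, Fintype (Ω i)]
    (p : ∀ i, Ω i → ℝ) (hp : ∀ i ω, 0 ≤ p i ω) (hp1 : ∀ i, ∑ ω, p i ω = 1)
    (v : ∀ i, Ω i → (Fin d → ℂ)) :
    ∑ ω : ∀ i, Ω i, ((∏ i, p i (ω i) : ℝ) : ℂ) •
        Matrix.charpoly (∑ i, Matrix.vecMulVec (v i (ω i)) (star (v i (ω i))))
      = MvPolynomial.eval (0 : Fin m → Polynomial ℂ)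
          ((List.finRange m).foldr (fun i q => q - MvPolynomial.pderiv i q)
            (Matrix.det
              ((MvPolynomial.C Polynomial.X : MvPolynomial (Fin m) (Polynomial ℂ)) •
                  (1 : Matrix (Fin d) (Fin d) (MvPolynomial (Fin m) (Polynomial ℂ)))
                + ∑ i, (MvPolynomial.X i : MvPolynomial (Fin m) (Polynomial ℂ)) •
                    (∑ ω : Ω i, ((p i ω : ℝ) : ℂ) •
                        Matrix.vecMulVec (v i ω) (star (v i ω))).map
                      (fun a => MvPolynomial.C (Polynomial.C a))))) := by
  have halg (c : ℂ) : algebraMap ℂ (MvPolynomial (Fin m) (Polynomial ℂ)) c =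
      MvPolynomial.C (Polynomial.C c) := rfl
  rw [show (fun (i : Fin m) (q : MvPolynomial (Fin m) (Polynomial ℂ)) =>
       q - MvPolynomial.pderiv i q) =
      fun i q => q - (MvPolynomial.pderiv i : Derivation _ _ _).restrictScalars ℂ q from rfl,
    Matrix.foldr_sub_derivation_det Ω _ (fun i ω => (p i ω : ℂ))
      (fun i => by exact_mod_cast hp1 i) v (fun i ω => star (v i ω)), map_sum]
  · refine Finset.sum_congr rfl fun ω _ => ?_
    rw [Algebra.smul_def, Algebra.smul_def, map_mul, RingHom.map_det, Matrix.charpoly, halg,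
      MvPolynomial.eval_C]
    push_cast
    refine congrArg₂ _ (by rw [map_prod]; rfl) (congrArg _ ?_)
    ext1 j k
    simp only [RingHom.mapMatrix_apply, Matrix.map_apply, Matrix.sub_apply, Matrix.add_apply,
      Matrix.sum_apply, halg]
    rcases eq_or_ne j k with rfl | hjk
    · simp [Matrix.sum_apply]
    · simp [Matrix.sum_apply, hjk]
  · intro i j k
    have h1 : MvPolynomial.pderiv i
        ((1 : Matrix (Fin d) (Fin d) (MvPolynomial (Fin m) (Polynomial ℂ))) j k) = 0 := by
      rw [Matrix.one_apply]
      split_ifs <;> simp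
    simp_rw [Algebra.smul_def (_ : ℂ) (_ : MvPolynomial _ _), halg]
    simp [Matrix.sum_apply, h1, Pi.single_apply, Matrix.vecMulVec_apply]
end

section
/- Let $A_1, \ldots, A_m$ be $d\times d$ Hermitian positive semidefinite matrices with $\sum_{i=1}^{m} A_i \leq I_d$ and $\mathrm{Tr}\, A_i \leq \varepsilon$ for all $i$, where $\varepsilon > 0$. Set $x = (1+\sqrt{\varepsilon})^2$ and $t = -(1+\sqrt{\varepsilon})$, and let $P(x,z) = \det(xI_d + \sum_{i=1}^m z_i A_i)$. Then for every $z \in \mathbb{R}^m$ with $z_i \geq t$ for all $i$, the point $(x, z)$ is above the roots of $P$ (i.e., $P(x', z') > 0$ whenever $x' \geq x$ and $z'_i \geq z_i$ for all $i$), and the barrier functions satisfy $\Phi_P^i(x,z) \leq \frac{\varepsilon}{x+t} = \frac{\sqrt{\varepsilon}}{1+\sqrt{\varepsilon}} < 1$ for every direction $i \in \{1,\ldots,m\}$. -/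
open scoped ComplexOrder

namespace MvPolynomial

/-- A partial derivative is the ordinary derivative of the restriction to a coordinate line. -/
lemma eval_pderiv_eq_eval_derivative_aeval {σ R : Type*} [CommRing R] [DecidableEq σ]
    (v : σ → R) (i : σ) (p : MvPolynomial σ R) :
    eval v (pderiv i p) =
      (Polynomial.derivative
        (aeval (fun j => Polynomial.C (v j) + if j = i then Polynomial.X else 0) p)).eval 0 := by
  have hev : ∀ q : MvPolynomial σ R,
      (aeval (fun j => Polynomial.C (v j) + if j = i then Polynomial.X else 0) q).eval 0
        = eval v q := by
    intro q
    induction q using MvPolynomial.induction_on with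
    | C a => simp
    | add p q hp hq => simp [hp, hq]
    | mul_X p j hp =>
      by_cases h : j = i <;> simp [hp, h]
  induction p using MvPolynomial.induction_on with
  | C a => simp
  | add p q hp hq => simp [hp, hq]
  | mul_X p j hp =>
    by_cases h : j = i
    · subst h
      simp [Derivation.leibniz, Polynomial.derivative_mul, hp, hev]
      ring
    · simp [Derivation.leibniz, Polynomial.derivative_mul, hp, h, pderiv_X]
      ring

end MvPolynomial

namespace Matrix

variable {n : Type*} [Fintype n] [DecidableEq n]

/-- **Jacobi's formula** along a line through an invertible matrix. -/
lemma eval_derivative_det_add_X_smul {R : Type*} [CommRing R] {M : Matrix n n R}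
    (hM : IsUnit M.det) (A : Matrix n n R) :
    (Polynomial.derivative
      (det (M.map Polynomial.C + (Polynomial.X : Polynomial R) • A.map Polynomial.C))).eval 0 =
      M.det * (M⁻¹ * A).trace := by
  have h : M.map Polynomial.C + (Polynomial.X : Polynomial R) • A.map Polynomial.C =
      M.map Polynomial.C *
        (1 + (Polynomial.X : Polynomial R) • (M⁻¹ * A).map Polynomial.C) := by
    rw [mul_add, mul_one, mul_smul_comm, ← Matrix.map_mul, mul_nonsing_inv_cancel_left _ _ hM]
  have hdet : (M.map Polynomial.C).det = Polynomial.C M.det :=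
    (RingHom.map_det Polynomial.C M).symm
  rw [h, det_mul, hdet, Polynomial.derivative_C_mul, Polynomial.eval_C_mul,
    derivative_det_one_add_X_smul]

lemma PosSemidef.trace_mul_nonneg_s12 {A B : Matrix n n ℂ} (hA : A.PosSemidef) (hB : B.PosSemidef) :
    0 ≤ (A * B).trace := by
  obtain ⟨C, rfl⟩ : ∃ C : Matrix n n ℂ, B = Cᴴ * C := by
    open scoped MatrixOrder in
    exact CStarAlgebra.nonneg_iff_eq_star_mul_self.mp hB.nonneg
  rw [← Matrix.mul_assoc, trace_mul_comm, ← Matrix.mul_assoc]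
  exact (hA.mul_mul_conjTranspose_same C).trace_nonneg

lemma posDef_of_posSemidef_sub_smul_one {ι : Type*} [DecidableEq ι] {M : Matrix ι ι ℂ} {c : ℝ}
    (hc : 0 < c) (hM : (M - (c : ℂ) • (1 : Matrix ι ι ℂ)).PosSemidef) : M.PosDef := by
  have h : ((c : ℂ) • (1 : Matrix ι ι ℂ)).PosDef :=
    PosDef.one.smul (by exact_mod_cast hc)
  simpa using PosDef.posSemidef_add hM h

/-- If `M ≥ c I` with `c > 0`, then `Tr (M⁻¹ A) ≤ Tr A / c` for positive semidefinite `A`. -/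
lemma trace_inv_mul_le {M A : Matrix n n ℂ} {c : ℝ} (hc : 0 < c)
    (hM : (M - (c : ℂ) • (1 : Matrix n n ℂ)).PosSemidef) (hA : A.PosSemidef) :
    (c : ℂ) * (M⁻¹ * A).trace ≤ A.trace := by
  have hpd := posDef_of_posSemidef_sub_smul_one hc hM
  have hu : IsUnit M.det := (isUnit_iff_isUnit_det _).mp hpd.isUnit
  have hc' : (0 : ℂ) ≤ c := by exact_mod_cast hc.le
  set N := M - (c : ℂ) • (1 : Matrix n n ℂ) with hN
  have hNM : N * N + (c : ℂ) • N = N * M := by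
    rw [show M = N + (c : ℂ) • (1 : Matrix n n ℂ) by simp [hN], mul_add]
    simp
  have hsq : (N * N + (c : ℂ) • N).PosSemidef := by
    refine PosSemidef.add ?_ (hM.smul hc')
    simpa [pow_two] using hM.pow 2
  have hps : (M⁻¹ * N).PosSemidef := by
    have h := hsq.mul_mul_conjTranspose_same M⁻¹
    rwa [hpd.inv.isHermitian.eq, hNM, Matrix.mul_assoc, mul_nonsing_inv_cancel_right _ _ hu] at h
  have h := hps.trace_mul_nonneg_s12 hA
  rw [hN, mul_sub, nonsing_inv_mul _ hu, sub_mul, one_mul, trace_sub] at h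
  simpa using h

end Matrix

/-- **Above the roots, with a bound on the barrier functions.**  Let
`A₁, …, Aₘ` be Hermitian positive semidefinite `d × d` complex matrices with
`∑ Aᵢ ≤ I` and `Tr Aᵢ ≤ ε`, where `ε > 0`.  Set `x = (1 + √ε)²`,
`t = -(1 + √ε)`, and `P = det(x I + ∑ zᵢ Aᵢ)` (a polynomial in the variables
`x = X 0`, `zᵢ = X (i+1)`).  Then for every `z : Fin m → ℝ` with `zᵢ ≥ t` for
all `i`, the point `(x, z)` is above the roots of `P` (i.e. `P` is a positive
real at every coordinatewise-larger real point), and for every direction `i`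
the barrier function satisfies
`Φ_P^i(x, z) ≤ ε / (x + t) = √ε / (1 + √ε) < 1`. -/
theorem above_roots_and_barrier_bound (d m : ℕ) (ε : ℝ) (hε : 0 < ε)
    (A : Fin m → Matrix (Fin d) (Fin d) ℂ)
    (hA : ∀ i, (A i).PosSemidef)
    (hsum : ((1 : Matrix (Fin d) (Fin d) ℂ) - ∑ i, A i).PosSemidef)
    (htr : ∀ i, (A i).trace ≤ (ε : ℂ))
    (x t : ℝ) (hx : x = (1 + Real.sqrt ε) ^ 2) (ht : t = -(1 + Real.sqrt ε))
    (P : MvPolynomial (Fin (m + 1)) ℂ)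
    (hP : P = Matrix.det
        ((MvPolynomial.X 0 : MvPolynomial (Fin (m + 1)) ℂ) •
            (1 : Matrix (Fin d) (Fin d) (MvPolynomial (Fin (m + 1)) ℂ))
          + ∑ i : Fin m, (MvPolynomial.X i.succ : MvPolynomial (Fin (m + 1)) ℂ) •
              (A i).map MvPolynomial.C))
    (z : Fin m → ℝ) (hz : ∀ i, t ≤ z i) :
    (∀ x' : ℝ, x ≤ x' → ∀ z' : Fin m → ℝ, (∀ i, z i ≤ z' i) →
        0 < MvPolynomial.eval (Fin.cons (x' : ℂ) (fun i => (z' i : ℂ))) P) ∧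
    (∀ i : Fin m,
        MvPolynomial.eval (Fin.cons (x : ℂ) (fun j => (z j : ℂ)))
            (MvPolynomial.pderiv i.succ P)
          / MvPolynomial.eval (Fin.cons (x : ℂ) (fun j => (z j : ℂ))) P
        ≤ ((ε / (x + t) : ℝ) : ℂ)) ∧
    ε / (x + t) = Real.sqrt ε / (1 + Real.sqrt ε) ∧
    Real.sqrt ε / (1 + Real.sqrt ε) < 1 := by
  have hs : 0 < Real.sqrt ε := Real.sqrt_pos.mpr hε
  have hss : Real.sqrt ε * Real.sqrt ε = ε := Real.mul_self_sqrt hε.le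
  have hxt : x + t = Real.sqrt ε * (1 + Real.sqrt ε) := by subst hx ht; ring
  have hc : 0 < x + t := by rw [hxt]; positivity
  have heval : ∀ (x' : ℝ) (z' : Fin m → ℝ),
      MvPolynomial.eval (Fin.cons (x' : ℂ) (fun i => (z' i : ℂ))) P =
        ((x' : ℂ) • (1 : Matrix (Fin d) (Fin d) ℂ) + ∑ i, (z' i : ℂ) • A i).det := by
    intro x' z'
    rw [hP, RingHom.map_det]
    congr 1
    ext a b
    simp [Matrix.sum_apply, Matrix.one_apply, apply_ite]
  have hps : ∀ (x' : ℝ), x ≤ x' → ∀ z' : Fin m → ℝ, (∀ i, z i ≤ z' i) →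
      (((x' : ℂ) • (1 : Matrix (Fin d) (Fin d) ℂ) + ∑ i, (z' i : ℂ) • A i) -
        ((x + t : ℝ) : ℂ) • (1 : Matrix (Fin d) (Fin d) ℂ)).PosSemidef := by
    intro x' hx' z' hz'
    have h₁ : (((x' - x : ℝ) : ℂ) • (1 : Matrix (Fin d) (Fin d) ℂ)).PosSemidef :=
      Matrix.PosSemidef.one.smul (by exact_mod_cast sub_nonneg.mpr hx')
    have h₂ : (∑ i, ((z' i - t : ℝ) : ℂ) • A i).PosSemidef :=
      Matrix.posSemidef_sum _ fun i _ => (hA i).smul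
        (by exact_mod_cast sub_nonneg.mpr ((hz i).trans (hz' i)))
    have h₃ : (((-t : ℝ) : ℂ) • ((1 : Matrix (Fin d) (Fin d) ℂ) - ∑ i, A i)).PosSemidef :=
      hsum.smul (by rw [ht, neg_neg]; exact_mod_cast (by positivity : 0 ≤ 1 + Real.sqrt ε))
    convert (h₁.add h₂).add h₃ using 1
    simp only [Complex.ofReal_sub, Complex.ofReal_add, Complex.ofReal_neg, sub_smul, add_smul,
      neg_smul, smul_sub, Finset.sum_sub_distrib, Finset.smul_sum,
      Finset.sum_neg_distrib]
    abel
  refine ⟨fun x' hx' z' hz' => ?_, fun i => ?_, ?_, ?_⟩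
  · rw [heval]
    exact (Matrix.posDef_of_posSemidef_sub_smul_one hc (hps x' hx' z' hz')).det_pos
  · have hM := hps x le_rfl z fun _ => le_rfl
    have hdet := (Matrix.posDef_of_posSemidef_sub_smul_one hc hM).det_pos
    have hderiv : MvPolynomial.eval (Fin.cons (x : ℂ) (fun j => (z j : ℂ)))
        (MvPolynomial.pderiv i.succ P) =
        ((x : ℂ) • (1 : Matrix (Fin d) (Fin d) ℂ) + ∑ i, (z i : ℂ) • A i).det *
          (((x : ℂ) • (1 : Matrix (Fin d) (Fin d) ℂ) + ∑ i, (z i : ℂ) • A i)⁻¹ * A i).trace := by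
      rw [MvPolynomial.eval_pderiv_eq_eval_derivative_aeval,
        ← Matrix.eval_derivative_det_add_X_smul hdet.ne'.isUnit, hP, AlgHom.map_det]
      congr 3
      ext1 a b
      by_cases hab : a = b
      · simp [Matrix.sum_apply, hab, add_mul, Finset.sum_add_distrib, (Fin.succ_ne_zero i).symm]
        ring
      · simp [Matrix.sum_apply, hab, add_mul, Finset.sum_add_distrib]
    rw [heval, hderiv, mul_div_cancel_left₀ _ hdet.ne', Complex.ofReal_div,
      le_div_iff₀ (by exact_mod_cast hc), mul_comm]
    exact (Matrix.trace_inv_mul_le hc hM (hA i)).trans (htr i)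
  · rw [hxt, div_eq_div_iff (by positivity) (by positivity)]
    linear_combination -(1 + Real.sqrt ε) * hss
  · rw [div_lt_one (by positivity)]
    linarith
end
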